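/- Let a, b, r be real numbers with a > b > r > 0 and r > b^2/a, and let G(x,y,a,b,r) be the degree-twelve polynomial defined in the context. Set A = (a*b*r)^(1/3) (the real cube root of a*b*r), δ = -3*b^2*a^2*r^2 + r^2*a^2*A^2 + 3*A*b^3*a*r - b^4*A^2, and ε = -a^4*A^2 + 3*A*b*r*a^3 - 3*b^2*a^2*r^2 + A^2*b^2*r^2. Then δ/((a^2 - b^2)*A^2) ≥ 0 and (b^2 - a^2)*ε ≥ 0, and with ξ = sqrt(δ/((a^2 - b^2)*A^2)) and η = sqrt((b^2 - a^2)*ε)/(A*(a^2 - b^2)), each of the four points (ξ, η), (-ξ, η), (ξ, -η), (-ξ, -η) lies on the variety V(G) and is a critical point of G as a function of (x,y): at each of these points G = 0, ∂G/∂x = 0 and ∂G/∂y = 0, where the partial derivatives are taken with respect to x and y with a, b, r held fixed. -/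

import Mathlib

set_option maxHeartbeats 2000000
set_option maxRecDepth 100000

/-- The degree-twelve polynomial defining the parallel lines to the ellipse
b^2*y^2 + a^2*x^2 = a^2*b^2 at offset r. -/
noncomputable def GEll (x y a b r : ℝ) : ℝ :=
  6*b^4*x^4*a^4 - 4*y^6*b^4*a^2 - 6*a^6*x^4*b^2 - 4*b^6*x^2*a^4 + 6*b^4*x^2*a^6 + a^4*b^8 -
    2*y^2*b^8*a^2 + 6*y^2*b^6*x^2*a^2 + 6*a^6*y^2*x^2*b^2 - 10*b^4*x^2*a^4*y^2 + y^8*b^4 +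
    b^8*r^4 + b^4*r^8 - 2*b^6*r^6 - 2*b^4*y^2*x^4*r^2 - 6*x^2*y^4*b^4*r^2 + 6*x^2*b^4*r^4*y^2 -
    4*b^4*y^6*r^2 + 2*b^4*y^6*x^2 + y^4*b^4*x^4 + b^4*x^4*r^4 - 2*b^4*r^6*x^2 - 2*b^6*x^2*r^4 +
    6*y^4*b^4*r^4 - 2*b^8*y^2*r^2 + 6*b^6*r^4*y^2 - 4*b^4*r^6*y^2 + 6*a^4*y^2*b^6 +
    6*a^6*y^2*b^2*r^2 + 2*a^4*b^2*x^4*y^2 - 4*a^4*x^6*b^2 + 4*a^6*x^2*b^2*r^2 -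
    8*b^4*x^2*a^4*r^2 + 10*a^4*x^4*b^2*r^2 - 6*b^4*r^2*a^2*x^2*y^2 - 6*a^4*x^2*b^2*r^2*y^2 -
    8*a^4*x^2*b^2*r^4 - 6*b^4*r^2*a^2*x^4 + 4*b^4*r^4*a^2*x^2 - 6*y^4*a^4*b^2*x^2 -
    6*b^4*x^4*a^2*y^2 + 6*b^6*x^2*r^2*a^2 + 2*b^4*x^2*y^4*a^2 + 10*b^4*y^4*a^2*r^2 +
    4*b^6*y^2*r^2*a^2 - 8*b^4*y^2*r^4*a^2 - 8*b^4*y^2*a^4*r^2 + 2*r^6*a^2*b^4 + a^8*b^4 -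
    6*a^4*y^4*r^2*b^2 + 4*a^4*y^2*r^4*b^2 - 2*a^8*b^2*x^2 + x^4*a^4*y^4 + 4*x^2*b^6*y^2*r^2 -
    6*y^4*b^6*a^2 - 4*a^6*y^2*b^4 - 2*y^4*a^4*x^2*r^2 + 2*b^2*r^2*a^2*x^4*y^2 - 2*r^8*a^2*b^2 +
    r^8*a^4 + a^8*x^4 + a^4*x^8 - 4*a^4*x^6*r^2 + 6*a^4*x^4*r^4 + 2*b^2*r^2*a^2*x^6 -
    6*b^2*r^4*a^2*x^4 - 2*a^6*r^6 + 2*a^6*x^6 + a^8*r^4 + 2*y^6*b^2*a^2*x^2 - 2*r^6*a^4*y^2 +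
    6*r^6*b^2*y^2*a^2 - 2*a^8*x^2*r^2 + y^4*a^4*r^4 - 6*y^4*b^2*r^4*a^2 - 2*a^6*y^2*r^4 +
    4*x^2*a^6*y^2*r^2 + 6*x^2*a^4*y^2*r^4 + 2*y^4*b^2*x^2*a^2*r^2 - 10*x^2*b^2*y^2*r^4*a^2 +
    2*y^6*b^2*a^2*r^2 + 6*r^6*b^2*x^2*a^2 + 4*b^2*x^4*y^4*a^2 + 2*a^4*x^6*y^2 - 6*a^6*x^4*r^2 -
    4*r^6*a^4*x^2 + 2*b^2*x^6*a^2*y^2 + 6*r^4*a^6*x^2 - 6*a^4*x^4*r^2*y^2 + 2*b^6*y^6 -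
    2*a^8*b^2*r^2 - 2*x^2*y^4*b^6 + 6*a^4*y^4*b^4 + y^4*b^8 - 6*y^4*b^6*r^2 - 2*x^4*a^6*y^2 -
    2*a^6*b^6 + 2*b^6*r^4*a^2 - 2*b^8*r^2*a^2 + 2*b^4*a^6*r^2 - 6*b^4*a^4*r^4 + 2*r^2*a^4*b^6 +
    2*r^4*a^6*b^2 + 2*r^6*a^4*b^2

/-- The real cube root of a*b*r. -/
noncomputable def AEll (a b r : ℝ) : ℝ := (a*b*r)^((1:ℝ)/3)

/-- δ, the numerator in the squared x-coordinates of the off-axis singular points. -/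
noncomputable def deltaEll (a b r : ℝ) : ℝ :=
  -3*b^2*a^2*r^2 + r^2*a^2*(AEll a b r)^2 + 3*(AEll a b r)*b^3*a*r - b^4*(AEll a b r)^2

/-- ε, the quantity appearing in the y-coordinates of the off-axis singular points. -/
noncomputable def epsEll (a b r : ℝ) : ℝ :=
  -a^4*(AEll a b r)^2 + 3*(AEll a b r)*b*r*a^3 - 3*b^2*a^2*r^2 + (AEll a b r)^2*b^2*r^2

/-- The x-coordinate ξ of the off-axis singular points. -/
noncomputable def xiEll (a b r : ℝ) : ℝ :=
  Real.sqrt (deltaEll a b r / ((a^2 - b^2)*(AEll a b r)^2))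

/-- The y-coordinate η of the off-axis singular points. -/
noncomputable def etaEll (a b r : ℝ) : ℝ :=
  Real.sqrt ((b^2 - a^2)*epsEll a b r) / (AEll a b r * (a^2 - b^2))

/-- Coefficient of degree 0 of the polynomial in one squared variable. -/
noncomputable def cx0 (Z p q R : ℝ) : ℝ :=
  (-4)*Z^3*p^1*q^2*R^0 +
    (1)*Z^0*p^2*q^4*R^0 +
    (-2)*Z^1*p^1*q^4*R^0 +
    (1)*Z^4*p^0*q^2*R^0 +
    (1)*Z^0*p^0*q^4*R^2 +
    (1)*Z^0*p^0*q^2*R^4 +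
    (-2)*Z^0*p^0*q^3*R^3 +
    (-4)*Z^3*p^0*q^2*R^1 +
    (6)*Z^2*p^0*q^2*R^2 +
    (-2)*Z^1*p^0*q^4*R^1 +
    (6)*Z^1*p^0*q^3*R^2 +
    (-4)*Z^1*p^0*q^2*R^3 +
    (6)*Z^1*p^2*q^3*R^0 +
    (6)*Z^1*p^3*q^1*R^1 +
    (10)*Z^2*p^1*q^2*R^1 +
    (4)*Z^1*p^1*q^3*R^1 +
    (-8)*Z^1*p^1*q^2*R^2 +
    (-8)*Z^1*p^2*q^2*R^1 +
    (2)*Z^0*p^1*q^2*R^3 +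
    (1)*Z^0*p^4*q^2*R^0 +
    (-6)*Z^2*p^2*q^1*R^1 +
    (4)*Z^1*p^2*q^1*R^2 +
    (-6)*Z^2*p^1*q^3*R^0 +
    (-4)*Z^1*p^3*q^2*R^0 +
    (-2)*Z^0*p^1*q^1*R^4 +
    (1)*Z^0*p^2*q^0*R^4 +
    (-2)*Z^0*p^3*q^0*R^3 +
    (1)*Z^0*p^4*q^0*R^2 +
    (-2)*Z^1*p^2*q^0*R^3 +
    (6)*Z^1*p^1*q^1*R^3 +
    (1)*Z^2*p^2*q^0*R^2 +
    (-6)*Z^2*p^1*q^1*R^2 +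
    (-2)*Z^1*p^3*q^0*R^2 +
    (2)*Z^3*p^1*q^1*R^1 +
    (2)*Z^3*p^0*q^3*R^0 +
    (-2)*Z^0*p^4*q^1*R^1 +
    (6)*Z^2*p^2*q^2*R^0 +
    (1)*Z^2*p^0*q^4*R^0 +
    (-6)*Z^2*p^0*q^3*R^1 +
    (-2)*Z^0*p^3*q^3*R^0 +
    (2)*Z^0*p^1*q^3*R^2 +
    (-2)*Z^0*p^1*q^4*R^1 +
    (2)*Z^0*p^3*q^2*R^1 +
    (-6)*Z^0*p^2*q^2*R^2 +
    (2)*Z^0*p^2*q^3*R^1 +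
    (2)*Z^0*p^3*q^1*R^2 +
    (2)*Z^0*p^2*q^1*R^3

/-- Coefficient of degree 2 of the polynomial in one squared variable. -/
noncomputable def cx1 (Z p q R : ℝ) : ℝ :=
  (-4)*Z^0*p^2*q^3*R^0 +
    (6)*Z^0*p^3*q^2*R^0 +
    (6)*Z^1*p^1*q^3*R^0 +
    (6)*Z^1*p^3*q^1*R^0 +
    (-10)*Z^1*p^2*q^2*R^0 +
    (-6)*Z^2*p^0*q^2*R^1 +
    (6)*Z^1*p^0*q^2*R^2 +
    (2)*Z^3*p^0*q^2*R^0 +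
    (-2)*Z^0*p^0*q^2*R^3 +
    (-2)*Z^0*p^0*q^3*R^2 +
    (4)*Z^0*p^3*q^1*R^1 +
    (-8)*Z^0*p^2*q^2*R^1 +
    (-6)*Z^1*p^1*q^2*R^1 +
    (-6)*Z^1*p^2*q^1*R^1 +
    (-8)*Z^0*p^2*q^1*R^2 +
    (4)*Z^0*p^1*q^2*R^2 +
    (-6)*Z^2*p^2*q^1*R^0 +
    (6)*Z^0*p^1*q^3*R^1 +
    (2)*Z^2*p^1*q^2*R^0 +
    (-2)*Z^0*p^4*q^1*R^0 +
    (4)*Z^1*p^0*q^3*R^1 +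
    (-2)*Z^2*p^2*q^0*R^1 +
    (2)*Z^3*p^1*q^1*R^0 +
    (-2)*Z^0*p^4*q^0*R^1 +
    (4)*Z^1*p^3*q^0*R^1 +
    (6)*Z^1*p^2*q^0*R^2 +
    (2)*Z^2*p^1*q^1*R^1 +
    (-10)*Z^1*p^1*q^1*R^2 +
    (6)*Z^0*p^1*q^1*R^3 +
    (-4)*Z^0*p^2*q^0*R^3 +
    (6)*Z^0*p^3*q^0*R^2 +
    (-2)*Z^2*p^0*q^3*R^0

/-- Coefficient of degree 4 of the polynomial in one squared variable. -/
noncomputable def cx2 (Z p q R : ℝ) : ℝ :=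
  (6)*Z^0*p^2*q^2*R^0 +
    (-6)*Z^0*p^3*q^1*R^0 +
    (-2)*Z^1*p^0*q^2*R^1 +
    (1)*Z^2*p^0*q^2*R^0 +
    (1)*Z^0*p^0*q^2*R^2 +
    (2)*Z^1*p^2*q^1*R^0 +
    (10)*Z^0*p^2*q^1*R^1 +
    (-6)*Z^0*p^1*q^2*R^1 +
    (-6)*Z^1*p^1*q^2*R^0 +
    (1)*Z^2*p^2*q^0*R^0 +
    (2)*Z^1*p^1*q^1*R^1 +
    (1)*Z^0*p^4*q^0*R^0 +
    (6)*Z^0*p^2*q^0*R^2 +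
    (-6)*Z^0*p^1*q^1*R^2 +
    (4)*Z^2*p^1*q^1*R^0 +
    (-6)*Z^0*p^3*q^0*R^1 +
    (-6)*Z^1*p^2*q^0*R^1 +
    (-2)*Z^1*p^3*q^0*R^0

/-- Coefficient of degree 6 of the polynomial in one squared variable. -/
noncomputable def cx3 (Z p q R : ℝ) : ℝ :=
  (-4)*Z^0*p^2*q^1*R^0 +
    (-4)*Z^0*p^2*q^0*R^1 +
    (2)*Z^0*p^1*q^1*R^1 +
    (2)*Z^0*p^3*q^0*R^0 +
    (2)*Z^1*p^2*q^0*R^0 +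
    (2)*Z^1*p^1*q^1*R^0

/-- Coefficient of degree 8 of the polynomial in one squared variable. -/
noncomputable def cx4 (Z p q R : ℝ) : ℝ :=
  (1)*Z^0*p^2*q^0*R^0

/-- Coefficient of degree 0 of the polynomial in one squared variable. -/
noncomputable def cy0 (Z p q R : ℝ) : ℝ :=
  (6)*Z^2*p^2*q^2*R^0 +
    (-6)*Z^2*p^3*q^1*R^0 +
    (-4)*Z^1*p^2*q^3*R^0 +
    (6)*Z^1*p^3*q^2*R^0 +
    (1)*Z^0*p^2*q^4*R^0 +
    (1)*Z^0*p^0*q^4*R^2 +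
    (1)*Z^0*p^0*q^2*R^4 +
    (-2)*Z^0*p^0*q^3*R^3 +
    (1)*Z^2*p^0*q^2*R^2 +
    (-2)*Z^1*p^0*q^2*R^3 +
    (-2)*Z^1*p^0*q^3*R^2 +
    (-4)*Z^3*p^2*q^1*R^0 +
    (4)*Z^1*p^3*q^1*R^1 +
    (-8)*Z^1*p^2*q^2*R^1 +
    (10)*Z^2*p^2*q^1*R^1 +
    (-8)*Z^1*p^2*q^1*R^2 +
    (-6)*Z^2*p^1*q^2*R^1 +
    (4)*Z^1*p^1*q^2*R^2 +
    (6)*Z^1*p^1*q^3*R^1 +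
    (2)*Z^0*p^1*q^2*R^3 +
    (1)*Z^0*p^4*q^2*R^0 +
    (-2)*Z^1*p^4*q^1*R^0 +
    (-2)*Z^0*p^1*q^1*R^4 +
    (1)*Z^0*p^2*q^0*R^4 +
    (1)*Z^2*p^4*q^0*R^0 +
    (1)*Z^4*p^2*q^0*R^0 +
    (-4)*Z^3*p^2*q^0*R^1 +
    (6)*Z^2*p^2*q^0*R^2 +
    (2)*Z^3*p^1*q^1*R^1 +
    (-6)*Z^2*p^1*q^1*R^2 +
    (-2)*Z^0*p^3*q^0*R^3 +
    (2)*Z^3*p^3*q^0*R^0 +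
    (1)*Z^0*p^4*q^0*R^2 +
    (-2)*Z^1*p^4*q^0*R^1 +
    (6)*Z^1*p^1*q^1*R^3 +
    (-6)*Z^2*p^3*q^0*R^1 +
    (-4)*Z^1*p^2*q^0*R^3 +
    (6)*Z^1*p^3*q^0*R^2 +
    (-2)*Z^0*p^4*q^1*R^1 +
    (-2)*Z^0*p^3*q^3*R^0 +
    (2)*Z^0*p^1*q^3*R^2 +
    (-2)*Z^0*p^1*q^4*R^1 +
    (2)*Z^0*p^3*q^2*R^1 +
    (-6)*Z^0*p^2*q^2*R^2 +
    (2)*Z^0*p^2*q^3*R^1 +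
    (2)*Z^0*p^3*q^1*R^2 +
    (2)*Z^0*p^2*q^1*R^3

/-- Coefficient of degree 2 of the polynomial in one squared variable. -/
noncomputable def cy1 (Z p q R : ℝ) : ℝ :=
  (-2)*Z^0*p^1*q^4*R^0 +
    (6)*Z^1*p^1*q^3*R^0 +
    (6)*Z^1*p^3*q^1*R^0 +
    (-10)*Z^1*p^2*q^2*R^0 +
    (-2)*Z^2*p^0*q^2*R^1 +
    (6)*Z^1*p^0*q^2*R^2 +
    (-2)*Z^0*p^0*q^4*R^1 +
    (6)*Z^0*p^0*q^3*R^2 +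
    (-4)*Z^0*p^0*q^2*R^3 +
    (6)*Z^0*p^2*q^3*R^0 +
    (6)*Z^0*p^3*q^1*R^1 +
    (2)*Z^2*p^2*q^1*R^0 +
    (-6)*Z^1*p^1*q^2*R^1 +
    (-6)*Z^1*p^2*q^1*R^1 +
    (-6)*Z^2*p^1*q^2*R^0 +
    (4)*Z^0*p^1*q^3*R^1 +
    (-8)*Z^0*p^1*q^2*R^2 +
    (-8)*Z^0*p^2*q^2*R^1 +
    (4)*Z^0*p^2*q^1*R^2 +
    (4)*Z^1*p^0*q^3*R^1 +
    (-4)*Z^0*p^3*q^2*R^0 +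
    (2)*Z^2*p^1*q^1*R^1 +
    (-2)*Z^0*p^2*q^0*R^3 +
    (6)*Z^0*p^1*q^1*R^3 +
    (-2)*Z^0*p^3*q^0*R^2 +
    (4)*Z^1*p^3*q^0*R^1 +
    (6)*Z^1*p^2*q^0*R^2 +
    (-10)*Z^1*p^1*q^1*R^2 +
    (2)*Z^3*p^2*q^0*R^0 +
    (2)*Z^3*p^1*q^1*R^0 +
    (-6)*Z^2*p^2*q^0*R^1 +
    (-2)*Z^2*p^3*q^0*R^0

/-- Coefficient of degree 4 of the polynomial in one squared variable. -/
noncomputable def cy2 (Z p q R : ℝ) : ℝ :=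
  (-6)*Z^1*p^0*q^2*R^1 +
    (1)*Z^2*p^0*q^2*R^0 +
    (6)*Z^0*p^0*q^2*R^2 +
    (-6)*Z^1*p^2*q^1*R^0 +
    (2)*Z^1*p^1*q^2*R^0 +
    (10)*Z^0*p^1*q^2*R^1 +
    (-6)*Z^0*p^2*q^1*R^1 +
    (1)*Z^2*p^2*q^0*R^0 +
    (-6)*Z^0*p^1*q^3*R^0 +
    (-2)*Z^1*p^2*q^0*R^1 +
    (1)*Z^0*p^2*q^0*R^2 +
    (-6)*Z^0*p^1*q^1*R^2 +
    (2)*Z^1*p^1*q^1*R^1 +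
    (4)*Z^2*p^1*q^1*R^0 +
    (-2)*Z^1*p^0*q^3*R^0 +
    (6)*Z^0*p^2*q^2*R^0 +
    (1)*Z^0*p^0*q^4*R^0 +
    (-6)*Z^0*p^0*q^3*R^1

/-- Coefficient of degree 6 of the polynomial in one squared variable. -/
noncomputable def cy3 (Z p q R : ℝ) : ℝ :=
  (-4)*Z^0*p^1*q^2*R^0 +
    (-4)*Z^0*p^0*q^2*R^1 +
    (2)*Z^1*p^0*q^2*R^0 +
    (2)*Z^1*p^1*q^1*R^0 +
    (2)*Z^0*p^1*q^1*R^1 +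
    (2)*Z^0*p^0*q^3*R^0

/-- Coefficient of degree 8 of the polynomial in one squared variable. -/
noncomputable def cy4 (Z p q R : ℝ) : ℝ :=
  (1)*Z^0*p^0*q^2*R^0

lemma G_x (u t a b r : ℝ) : GEll u t a b r = cx0 (t^2) (a^2) (b^2) (r^2) * u^0 + cx1 (t^2) (a^2) (b^2) (r^2) * u^2 + cx2 (t^2) (a^2) (b^2) (r^2) * u^4 + cx3 (t^2) (a^2) (b^2) (r^2) * u^6 + cx4 (t^2) (a^2) (b^2) (r^2) * u^8 := by
  simp only [GEll, cx0, cx1, cx2, cx3, cx4]; ring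

lemma G_y (u t a b r : ℝ) : GEll t u a b r = cy0 (t^2) (a^2) (b^2) (r^2) * u^0 + cy1 (t^2) (a^2) (b^2) (r^2) * u^2 + cy2 (t^2) (a^2) (b^2) (r^2) * u^4 + cy3 (t^2) (a^2) (b^2) (r^2) * u^6 + cy4 (t^2) (a^2) (b^2) (r^2) * u^8 := by
  simp only [GEll, cy0, cy1, cy2, cy3, cy4]; ring

lemma even_deriv (k0 k1 k2 k3 k4 s X : ℝ) (hX : s^2 = X)
    (h : 1 * k1 * X^0 + 2 * k2 * X^1 + 3 * k3 * X^2 + 4 * k4 * X^3 = 0) :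
    deriv (fun u : ℝ => k0 * u^0 + k1 * u^2 + k2 * u^4 + k3 * u^6 + k4 * u^8) s = 0 := by
  have h1 : HasDerivAt (fun u : ℝ => k0 * u^0 + k1 * u^2 + k2 * u^4 + k3 * u^6 + k4 * u^8)
      (k0 * (((0:ℕ):ℝ) * s^(0-1)) + k1 * (((2:ℕ):ℝ) * s^(2-1)) + k2 * (((4:ℕ):ℝ) * s^(4-1))
        + k3 * (((6:ℕ):ℝ) * s^(6-1)) + k4 * (((8:ℕ):ℝ) * s^(8-1))) s :=
    (((((hasDerivAt_pow 0 s).const_mul k0).add ((hasDerivAt_pow 2 s).const_mul k1)).add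
      ((hasDerivAt_pow 4 s).const_mul k2)).add ((hasDerivAt_pow 6 s).const_mul k3)).add
      ((hasDerivAt_pow 8 s).const_mul k4)
  rw [h1.deriv]
  subst hX
  norm_num
  linear_combination (2 * s) * h

lemma H0 (p q c X Y R : ℝ) (hp : p ≠ 0) (hq : q ≠ 0) (hpq : p - q ≠ 0)
    (hX : X = (c - q)^3 / (q * (p - q))) (hY : Y = (p - c)^3 / (p * (p - q)))
    (hR : R = c^3 / (p * q)) :
    cx0 Y p q R * X^0 + cx1 Y p q R * X^1 + cx2 Y p q R * X^2 + cx3 Y p q R * X^3 + cx4 Y p q R * X^4 = 0 := by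
  simp only [cx0, cx1, cx2, cx3, cx4]
  subst hX hY hR
  field_simp
  ring

lemma Hx (p q c X Y R : ℝ) (hp : p ≠ 0) (hq : q ≠ 0) (hpq : p - q ≠ 0)
    (hX : X = (c - q)^3 / (q * (p - q))) (hY : Y = (p - c)^3 / (p * (p - q)))
    (hR : R = c^3 / (p * q)) :
    1 * cx1 Y p q R * X^0 + 2 * cx2 Y p q R * X^1 + 3 * cx3 Y p q R * X^2 + 4 * cx4 Y p q R * X^3 = 0 := by
  simp only [cx0, cx1, cx2, cx3, cx4]
  subst hX hY hR
  field_simp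
  ring

lemma Hy (p q c X Y R : ℝ) (hp : p ≠ 0) (hq : q ≠ 0) (hpq : p - q ≠ 0)
    (hX : X = (c - q)^3 / (q * (p - q))) (hY : Y = (p - c)^3 / (p * (p - q)))
    (hR : R = c^3 / (p * q)) :
    1 * cy1 X p q R * Y^0 + 2 * cy2 X p q R * Y^1 + 3 * cy3 X p q R * Y^2 + 4 * cy4 X p q R * Y^3 = 0 := by
  simp only [cy0, cy1, cy2, cy3, cy4]
  subst hX hY hR
  field_simp
  ring

theorem ellipse_offaxis_singular_points (a b r : ℝ) (hab : b < a) (hbr : r < b)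
    (hr : 0 < r) (hcrit : b^2/a < r) :
    0 ≤ deltaEll a b r / ((a^2 - b^2)*(AEll a b r)^2) ∧
    0 ≤ (b^2 - a^2)*epsEll a b r ∧
    ∀ s t : ℝ, (s = xiEll a b r ∨ s = -(xiEll a b r)) →
      (t = etaEll a b r ∨ t = -(etaEll a b r)) →
      (GEll s t a b r = 0 ∧
       deriv (fun u : ℝ => GEll u t a b r) s = 0 ∧
       deriv (fun u : ℝ => GEll s u a b r) t = 0) := by
  have ha : 0 < a := by linarith
  have hb : 0 < b := by linarith
  have hcr : b^2 < a * r := by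
    rw [div_lt_iff₀ ha] at hcrit; linarith
  have habr : 0 < a * b * r := by positivity
  have hA0 : 0 < AEll a b r := Real.rpow_pos_of_pos habr _
  have hA3 : (AEll a b r)^3 = a * b * r := by
    unfold AEll
    rw [← Real.rpow_natCast, ← Real.rpow_mul habr.le]
    norm_num
  have hdel : deltaEll a b r = (AEll a b r)^2 * ((AEll a b r)^2 - b^2)^3 / b^2 := by
    unfold deltaEll
    generalize AEll a b r = A at *
    have hr' : r = A^3 / (a * b) := by rw [hA3]; field_simp
    rw [hr']
    field_simp
    ring
  have heps : epsEll a b r = - ((AEll a b r)^2 * (a^2 - (AEll a b r)^2)^3 / a^2) := by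
    unfold epsEll
    generalize AEll a b r = A at *
    have hr' : r = A^3 / (a * b) := by rw [hA3]; field_simp
    rw [hr']
    field_simp
    ring
  have hbA : b < AEll a b r := by
    refine lt_of_pow_lt_pow_left₀ 3 hA0.le ?_
    rw [hA3]; nlinarith
  have hAa : AEll a b r < a := by
    refine lt_of_pow_lt_pow_left₀ 3 ha.le ?_
    rw [hA3]
    have h1 : b * r < a * a := by nlinarith
    nlinarith
  have hR : r^2 = ((AEll a b r)^2)^3 / (a^2 * b^2) := by
    have : ((AEll a b r)^2)^3 = (a * b * r)^2 := by rw [← hA3]; ring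
    rw [this]; field_simp
  have hcq : 0 < (AEll a b r)^2 - b^2 := by nlinarith
  have hpc : 0 < a^2 - (AEll a b r)^2 := by nlinarith
  have hpq : 0 < a^2 - b^2 := by linarith
  have hd : 0 ≤ deltaEll a b r / ((a^2 - b^2)*(AEll a b r)^2) := by
    rw [hdel]; positivity
  have he : 0 ≤ (b^2 - a^2)*epsEll a b r := by
    rw [heps, show (b^2 - a^2) * -((AEll a b r)^2 * (a^2 - (AEll a b r)^2)^3 / a^2)
      = (a^2 - b^2) * ((AEll a b r)^2 * (a^2 - (AEll a b r)^2)^3 / a^2) by ring]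
    positivity
  refine ⟨hd, he, ?_⟩
  intro s t hs ht
  have hX : s^2 = ((AEll a b r)^2 - b^2)^3 / (b^2 * (a^2 - b^2)) := by
    have h1 : s^2 = (xiEll a b r)^2 := by rcases hs with h | h <;> rw [h]; ring
    rw [h1, xiEll, Real.sq_sqrt hd, hdel]
    field_simp
  have hY : t^2 = (a^2 - (AEll a b r)^2)^3 / (a^2 * (a^2 - b^2)) := by
    have h1 : t^2 = (etaEll a b r)^2 := by rcases ht with h | h <;> rw [h]; ring
    rw [h1, etaEll, div_pow, Real.sq_sqrt he, heps]
    field_simp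
    ring
  have hp0 : a^2 ≠ 0 := by positivity
  have hq0 : b^2 ≠ 0 := by positivity
  refine ⟨?_, ?_, ?_⟩
  · rw [G_x, ← H0 (a^2) (b^2) ((AEll a b r)^2) (s^2) (t^2) (r^2) hp0 hq0 hpq.ne' hX hY hR]
    ring
  · simp only [G_x]
    exact even_deriv _ _ _ _ _ s (s^2) rfl
      (Hx (a^2) (b^2) ((AEll a b r)^2) (s^2) (t^2) (r^2) hp0 hq0 hpq.ne' hX hY hR)
  · simp only [G_y]
    exact even_deriv _ _ _ _ _ t (t^2) rfl
      (Hy (a^2) (b^2) ((AEll a b r)^2) (s^2) (t^2) (r^2) hp0 hq0 hpq.ne' hX hY hR)
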